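/- Suppose q is odd. Then the number of n×n matrices A over 𝔽_q satisfying A² = I equals Σ_{i=0}^{n} γ_n/(γ_i · γ_{n−i}). -/

import Mathlib

/-- `gam q n` is the order of `GL_n(F_q)`: `∏_{i=0}^{n-1} (q^n - q^i)`. -/
def gam (q n : ℕ) : ℕ := ∏ i ∈ Finset.range n, (q ^ n - q ^ i)

open Matrix

theorem card_GL_eq_gam {F ι : Type*} [Field F] [Fintype F] [Fintype ι] [DecidableEq ι] :
    Nat.card (GL ι F) = gam (Fintype.card F) (Fintype.card ι) := by
  rw [gam, ← Fin.prod_univ_eq_prod_range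
      (fun i => Fintype.card F ^ Fintype.card ι - Fintype.card F ^ i), ← card_GL_field]
  exact Nat.card_congr
    (Units.mapEquiv (reindexRingEquiv F (Fintype.equivFin ι)).toMulEquiv).toEquiv

theorem gam_pos {q : ℕ} (hq : 1 < q) (n : ℕ) : 0 < gam q n :=
  Finset.prod_pos fun _ hi => Nat.sub_pos_of_lt (Nat.pow_lt_pow_right hq (Finset.mem_range.1 hi))

section Idempotent

variable {F m k : Type*} [Field F] [Fintype m] [DecidableEq m] [Fintype k] [DecidableEq k]

theorem rank_fromBlocks_one_zero :
    (fromBlocks 1 0 0 0 : Matrix (m ⊕ k) (m ⊕ k) F).rank = Fintype.card m := by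
  classical
  rw [← diagonal_one, ← diagonal_zero, fromBlocks_diagonal, rank_diagonal]
  refine Fintype.card_congr (Equiv.symm (Equiv.ofBijective (fun i => ⟨Sum.inl i, by simp⟩) ⟨?_, ?_⟩))
  · intro i j h
    exact Sum.inl_injective (congrArg Subtype.val h)
  · rintro ⟨i | i, hi⟩
    · exact ⟨i, rfl⟩
    · simp at hi

/-- An idempotent matrix is similar to the standard idempotent of the same rank. -/
theorem exists_unit_mul_eq_mul_fromBlocks {E : Matrix (m ⊕ k) (m ⊕ k) F}
    (hE : IsIdempotentElem E) (hr : E.rank = Fintype.card m) :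
    ∃ g : GL (m ⊕ k) F, E * g.1 = g.1 * fromBlocks 1 0 0 0 := by
  have hT : IsIdempotentElem (toLin' E) := by
    rw [IsIdempotentElem, Module.End.mul_eq_comp, ← toLin'_mul, hE.eq]
  have hc := LinearMap.IsIdempotentElem.isCompl hT
  have hU : Module.finrank F (toLin' E).range = Fintype.card m := hr
  have hW : Module.finrank F (toLin' E).ker = Fintype.card k := by
    have := (toLin' E).finrank_range_add_finrank_ker
    rw [hU, Module.finrank_fintype_fun_eq_card, Fintype.card_sum] at this
    omega
  let b₁ : Module.Basis m F (toLin' E).range :=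
    (Module.finBasisOfFinrankEq F _ hU).reindex (Fintype.equivFin m).symm
  let b₂ : Module.Basis k F (toLin' E).ker :=
    (Module.finBasisOfFinrankEq F _ hW).reindex (Fintype.equivFin k).symm
  let b := (b₁.prod b₂).map (Submodule.prodEquivOfIsCompl _ _ hc)
  have hb₁ (i : m) : E *ᵥ b (Sum.inl i) = b (Sum.inl i) := by
    have h : b (Sum.inl i) = (b₁ i : m ⊕ k → F) := by simp [b]
    obtain ⟨v, hv⟩ := (b₁ i).2
    rw [h, ← hv, toLin'_apply, mulVec_mulVec, hE.eq]
  have hb₂ (i : k) : E *ᵥ b (Sum.inr i) = 0 := by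
    have h : b (Sum.inr i) = (b₂ i : m ⊕ k → F) := by simp [b]
    rw [h, ← toLin'_apply]
    exact (b₂ i).2
  let := (Pi.basisFun F (m ⊕ k)).invertibleToMatrix b
  refine ⟨unitOfInvertible ((Pi.basisFun F (m ⊕ k)).toMatrix b), ?_⟩
  rw [val_unitOfInvertible, Module.Basis.coePiBasisFun.toMatrix_eq_transpose,
    ← diagonal_one, ← diagonal_zero, fromBlocks_diagonal]
  ext i (j | j)
  · rw [mul_diagonal, Sum.elim_inl, mul_one]
    exact congrFun (hb₁ j) i
  · rw [mul_diagonal, Sum.elim_inr, mul_zero]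
    exact congrFun (hb₂ j) i

theorem orbit_conjAct_fromBlocks_one_zero :
    MulAction.orbit (ConjAct (GL (m ⊕ k) F)) (fromBlocks 1 0 0 0 : Matrix (m ⊕ k) (m ⊕ k) F)
      = {E | IsIdempotentElem E ∧ E.rank = Fintype.card m} := by
  ext E
  constructor
  · rintro ⟨g, rfl⟩
    refine ⟨?_, ?_⟩
    · change g • _ * g • _ = g • _
      rw [← smul_mul', fromBlocks_multiply]
      simp
    · change (g • _ : Matrix (m ⊕ k) (m ⊕ k) F).rank = _
      rw [ConjAct.units_smul_def,
        rank_mul_eq_left_of_isUnit_det _ _ ((isUnit_iff_isUnit_det _).1 (Units.isUnit _)),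
        rank_mul_eq_right_of_isUnit_det _ _ ((isUnit_iff_isUnit_det _).1 (Units.isUnit _)),
        rank_fromBlocks_one_zero]
  · rintro ⟨hE, hr⟩
    obtain ⟨g, hg⟩ := exists_unit_mul_eq_mul_fromBlocks hE hr
    refine ⟨ConjAct.toConjAct g, ?_⟩
    change ConjAct.toConjAct g • _ = E
    rw [ConjAct.units_smul_def, ConjAct.ofConjAct_toConjAct, ← hg, Units.mul_inv_cancel_right]

theorem mem_stabilizer_fromBlocks_one_zero {g : ConjAct (GL (m ⊕ k) F)} :
    g ∈ MulAction.stabilizer (ConjAct (GL (m ⊕ k) F))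
        (fromBlocks 1 0 0 0 : Matrix (m ⊕ k) (m ⊕ k) F) ↔
      ∃ (a : Matrix m m F) (d : Matrix k k F),
        (ConjAct.ofConjAct g).1 = fromBlocks a 0 0 d := by
  rw [MulAction.mem_stabilizer_iff, ConjAct.units_smul_def, Units.mul_inv_eq_iff_eq_mul]
  generalize (ConjAct.ofConjAct g).1 = M
  constructor
  · intro h
    rw [← fromBlocks_toBlocks M] at h ⊢
    simp only [fromBlocks_multiply, fromBlocks_inj, Matrix.mul_zero, Matrix.zero_mul,
      Matrix.mul_one, Matrix.one_mul, add_zero] at h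
    exact ⟨_, _, by rw [h.2.2.1, ← h.2.1]⟩
  · rintro ⟨a, d, rfl⟩
    simp [fromBlocks_multiply]

theorem card_stabilizer_fromBlocks_one_zero :
    Nat.card (MulAction.stabilizer (ConjAct (GL (m ⊕ k) F))
        (fromBlocks 1 0 0 0 : Matrix (m ⊕ k) (m ⊕ k) F))
      = Nat.card (GL m F) * Nat.card (GL k F) := by
  rw [← Nat.card_prod]
  have hu (p : GL m F × GL k F) :
      IsUnit (fromBlocks p.1.1 0 0 p.2.1 : Matrix (m ⊕ k) (m ⊕ k) F) :=
    isUnit_fromBlocks_zero₂₁.2 ⟨p.1.isUnit, p.2.isUnit⟩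
  symm
  refine Nat.card_congr (Equiv.ofBijective
    (fun p => ⟨ConjAct.toConjAct (hu p).unit,
      mem_stabilizer_fromBlocks_one_zero.2 ⟨p.1.1, p.2.1, rfl⟩⟩) ⟨?_, ?_⟩)
  · intro p p' h
    have h' : (fromBlocks p.1.1 0 0 p.2.1 : Matrix (m ⊕ k) (m ⊕ k) F)
        = fromBlocks p'.1.1 0 0 p'.2.1 :=
      congrArg (fun g : GL (m ⊕ k) F => g.1) (congrArg Subtype.val h)
    rw [fromBlocks_inj] at h'
    exact Prod.ext (Units.ext h'.1) (Units.ext h'.2.2.2)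
  · rintro ⟨g, hg⟩
    obtain ⟨a, d, h⟩ := mem_stabilizer_fromBlocks_one_zero.1 hg
    have had : IsUnit a ∧ IsUnit d := by
      rw [← isUnit_fromBlocks_zero₂₁ (B := 0), ← h]
      exact Units.isUnit _
    exact ⟨(had.1.unit, had.2.unit), Subtype.ext (Units.ext h.symm)⟩

theorem card_idempotent_rank_sum_mul [Fintype F] :
    Nat.card {E : Matrix (m ⊕ k) (m ⊕ k) F // IsIdempotentElem E ∧ E.rank = Fintype.card m}
        * (Nat.card (GL m F) * Nat.card (GL k F)) = Nat.card (GL (m ⊕ k) F) := by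
  rw [← card_stabilizer_fromBlocks_one_zero, ← Nat.card_prod]
  have h := Nat.card_congr (MulAction.orbitProdStabilizerEquivGroup (ConjAct (GL (m ⊕ k) F))
    (fromBlocks 1 0 0 0 : Matrix (m ⊕ k) (m ⊕ k) F))
  rw [orbit_conjAct_fromBlocks_one_zero] at h
  exact h

end Idempotent

theorem card_idempotent_rank_mul {F : Type*} [Field F] [Fintype F] {n i : ℕ} (hi : i ≤ n) :
    Nat.card {E : Matrix (Fin n) (Fin n) F // IsIdempotentElem E ∧ E.rank = i}
        * (gam (Fintype.card F) i * gam (Fintype.card F) (n - i)) = gam (Fintype.card F) n := by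
  have h := card_idempotent_rank_sum_mul (F := F) (m := Fin i) (k := Fin (n - i))
  simp only [card_GL_eq_gam, Fintype.card_sum, Fintype.card_fin, Nat.add_sub_cancel' hi] at h
  rw [← h]
  congr 1
  let e : Fin n ≃ Fin i ⊕ Fin (n - i) := (finCongr (by omega)).trans finSumFinEquiv.symm
  refine Nat.card_congr ((reindexRingEquiv F e).toEquiv.subtypeEquiv fun E => ?_)
  refine and_congr ?_ ?_
  · change E * E = E ↔ reindexRingEquiv F e E * reindexRingEquiv F e E = reindexRingEquiv F e E
    rw [← map_mul, (reindexRingEquiv F e).injective.eq_iff]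
  · exact (congrArg (· = i) (rank_reindex e e E)).to_iff.symm

/-- Where `2` is invertible, square roots of `1` correspond to idempotents via `a ↦ (a + 1) / 2`. -/
def sqEqOneEquivIdempotent (R : Type*) [Ring R] [Invertible (2 : R)] :
    {a : R // a ^ 2 = 1} ≃ {e : R // IsIdempotentElem e} where
  toFun a := ⟨⅟2 * (a.1 + 1), by
    have hc : Commute (⅟(2 : R)) (a.1 + 1) := ((Commute.ofNat_left 2 _).invOf_left)
    have ha := a.2
    have h2 : (a.1 + 1) * (a.1 + 1) = 2 * (a.1 + 1) := by
      rw [pow_two] at ha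
      rw [add_mul, mul_add, ha]
      noncomm_ring
    rw [IsIdempotentElem, mul_assoc, ← mul_assoc (a.1 + 1), ← hc.eq, mul_assoc, h2,
      invOf_mul_cancel_left]⟩
  invFun e := ⟨2 * e.1 - 1, by
    have he : e.1 * e.1 = e.1 := e.2
    have : (2 * e.1 - 1) ^ 2 = 4 * (e.1 * e.1) - 4 * e.1 + 1 := by noncomm_ring
    rw [this, he]
    simp⟩
  left_inv a := by simp
  right_inv e := by simp

theorem card_idempotent_eq_sum {F : Type*} [Field F] [Fintype F] (n : ℕ) :
    Nat.card {E : Matrix (Fin n) (Fin n) F // IsIdempotentElem E}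
      = ∑ i ∈ Finset.range (n + 1),
          Nat.card {E : Matrix (Fin n) (Fin n) F // IsIdempotentElem E ∧ E.rank = i} := by
  classical
  simp only [Nat.card_eq_fintype_card, Fintype.card_subtype]
  rw [Finset.card_eq_sum_card_fiberwise (f := Matrix.rank) (t := Finset.range (n + 1))]
  · simp only [Finset.filter_filter]
  · intro E _
    have := E.rank_le_width
    simpa using Nat.lt_succ_of_le this

theorem involutionCount_eq_sum_of_odd {F : Type} [Field F] [Fintype F] (q : ℕ)
    (hq : Fintype.card F = q) (hodd : Odd q) (n : ℕ) :
    (Nat.card {A : Matrix (Fin n) (Fin n) F // A ^ 2 = 1} : ℚ)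
      = ∑ i ∈ Finset.range (n + 1), (gam q n : ℚ) / ((gam q i : ℚ) * (gam q (n - i) : ℚ)) := by
  subst hq
  have h2 : (2 : F) ≠ 0 := Ring.two_ne_zero fun h =>
    Nat.not_even_iff_odd.2 hodd (FiniteField.even_card_of_char_two h |> Nat.even_iff.2)
  let : Invertible (2 : F) := invertibleOfNonzero h2
  let : Invertible (2 : Matrix (Fin n) (Fin n) F) :=
    (Invertible.map (algebraMap F (Matrix (Fin n) (Fin n) F)) 2).copy _ (map_ofNat _ 2).symm
  rw [Nat.card_congr (sqEqOneEquivIdempotent _), card_idempotent_eq_sum, Nat.cast_sum]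
  refine Finset.sum_congr rfl fun i hi => ?_
  have hpos (j : ℕ) : (gam (Fintype.card F) j : ℚ) ≠ 0 :=
    Nat.cast_ne_zero.2 (gam_pos Fintype.one_lt_card j).ne'
  rw [eq_div_iff (mul_ne_zero (hpos _) (hpos _))]
  exact_mod_cast card_idempotent_rank_mul (Nat.lt_succ_iff.1 (Finset.mem_range.1 hi))
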